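/- Let H and K be n×n positive-definite Hermitian complex matrices. Then tr(H⁻¹K) + tr(K⁻¹H) is a real number, it satisfies tr(H⁻¹K) + tr(K⁻¹H) ≥ 2n, and equality holds if and only if H = K. -/

import Mathlib

open Matrix
open scoped ComplexOrder

/-- A positive-definite matrix is of the form `Bᴴ * B` with `B` invertible. -/
theorem Matrix.PosDef.exists_isUnit_eq_conjTranspose_mul_self {m : Type*} [Fintype m]
    [DecidableEq m] {A : Matrix m m ℂ} (hA : A.PosDef) :
    ∃ B : Matrix m m ℂ, IsUnit B ∧ A = Bᴴ * B := by
  obtain ⟨B, hB⟩ : ∃ B : Matrix m m ℂ, A = Bᴴ * B := by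
    open scoped MatrixOrder in
    exact CStarAlgebra.nonneg_iff_eq_star_mul_self.mp hA.posSemidef.nonneg
  refine ⟨B, ?_, hB⟩
  have h := hA.isUnit
  rw [isUnit_iff_isUnit_det, hB, det_mul] at h
  exact (isUnit_iff_isUnit_det B).mpr (isUnit_of_mul_isUnit_right h)

/-- The trace of `A * D * B * D`, with `A` and `B` positive definite and `D`
Hermitian, is nonnegative and vanishes only for `D = 0`. -/
theorem Matrix.PosDef.trace_mul_mul_mul_nonneg {m : Type*} [Fintype m] [DecidableEq m]
    {A B D : Matrix m m ℂ} (hA : A.PosDef) (hB : B.PosDef) (hD : D.IsHermitian) :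
    0 ≤ trace (A * D * B * D) ∧ (trace (A * D * B * D) = 0 ↔ D = 0) := by
  obtain ⟨P, hP, rfl⟩ := hA.exists_isUnit_eq_conjTranspose_mul_self
  obtain ⟨Q, hQ, rfl⟩ := hB.exists_isUnit_eq_conjTranspose_mul_self
  have key : trace (Pᴴ * P * D * (Qᴴ * Q) * D) = trace ((Q * D * Pᴴ) * (Q * D * Pᴴ)ᴴ) := by
    rw [show Pᴴ * P * D * (Qᴴ * Q) * D = (Pᴴ * P * D * Qᴴ) * (Q * D) by
      simp only [Matrix.mul_assoc], trace_mul_comm]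
    simp only [conjTranspose_mul, conjTranspose_conjTranspose, hD.eq, Matrix.mul_assoc]
  rw [key]
  refine ⟨(posSemidef_self_mul_conjTranspose _).trace_nonneg, ?_⟩
  have hP' : IsUnit Pᴴ := hP.star
  rw [trace_mul_conjTranspose_self_eq_zero_iff, hP'.mul_left_eq_zero, hQ.mul_right_eq_zero]

/-- Let `H` and `K` be `n × n` positive-definite Hermitian complex matrices. Then
`tr(H⁻¹K) + tr(K⁻¹H)` is a real number, it satisfies `tr(H⁻¹K) + tr(K⁻¹H) ≥ 2n`,
and equality holds if and only if `H = K`. -/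
theorem donaldson_distance_nonneg
    (n : ℕ) (H K : Matrix (Fin n) (Fin n) ℂ)
    (hH : H.PosDef) (hK : K.PosDef) :
    (Matrix.trace (H⁻¹ * K) + Matrix.trace (K⁻¹ * H)).im = 0 ∧
      2 * (n : ℝ) ≤ (Matrix.trace (H⁻¹ * K) + Matrix.trace (K⁻¹ * H)).re ∧
      ((Matrix.trace (H⁻¹ * K) + Matrix.trace (K⁻¹ * H)).re = 2 * (n : ℝ) ↔ H = K) := by
  obtain ⟨h0, hiff⟩ := hH.inv.trace_mul_mul_mul_nonneg hK.inv
    (hK.isHermitian.sub hH.isHermitian)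
  have hHu := (isUnit_iff_isUnit_det H).mp hH.isUnit
  have hKu := (isUnit_iff_isUnit_det K).mp hK.isUnit
  have key : trace (H⁻¹ * K) + trace (K⁻¹ * H) =
      trace (H⁻¹ * (K - H) * K⁻¹ * (K - H)) + ((2 * n : ℝ) : ℂ) := by
    have : H⁻¹ * (K - H) * K⁻¹ * (K - H) = H⁻¹ * K + K⁻¹ * H - 1 - 1 := by
      rw [Matrix.mul_assoc (H⁻¹ * (K - H)), Matrix.mul_sub, Matrix.mul_sub,
        nonsing_inv_mul _ hHu, nonsing_inv_mul _ hKu, Matrix.sub_mul, Matrix.mul_sub,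
        Matrix.mul_assoc H⁻¹ K (K⁻¹ * H), mul_nonsing_inv_cancel_left _ _ hKu,
        nonsing_inv_mul _ hHu]
      simp only [Matrix.mul_one, Matrix.one_mul]
      abel
    rw [this]
    simp only [trace_sub, trace_add, trace_one, Fintype.card_fin]
    push_cast
    ring
  obtain ⟨hre, him⟩ := Complex.le_def.mp h0
  rw [key, Complex.add_re, Complex.add_im, Complex.ofReal_re, Complex.ofReal_im, ← him]
  refine ⟨by simp, by simpa using hre, ?_⟩
  rw [add_eq_right, eq_comm (a := H), ← sub_eq_zero (a := K), ← hiff, Complex.ext_iff]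
  simp [← him]
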